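/- arXiv:1602.00748 — 2 statements merged into one kernel-verified Lean document; each statement's English description precedes it below -/
import Mathlib

section
/- Let E be a Gysin functor on a finitary lextensive category C, and suppose given morphisms f : Z → Y and g : Z → X in C and an element a ∈ E(Z). Then in the category of correspondences C_E: (a) Rf ∘ Da ∘ Ig = ((f, g) : Z → Y × X)_!(a); (b) Rf ∘ Da ∘ If = D(f_!(a)); (c) Rf ∘ If = D(f_!(1)). -/
open CategoryTheory CategoryTheory.Limits

universe v u

/-- A Gysin functor on a finitary lextensive category `C`. -/
structure GysinFunctor (C : Type u) [Category.{v} C] [HasFiniteLimits C]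
    [HasFiniteCoproducts C] [FinitaryExtensive C] where
  /-- The underlying rings. -/
  E : C → Type v
  commRing : ∀ X : C, CommRing (E X)
  /-- Contravariant functoriality (pullback), by ring maps. -/
  pull : ∀ {X Y : C}, (X ⟶ Y) → (E Y →+* E X)
  pull_id : ∀ X : C, pull (𝟙 X) = RingHom.id (E X)
  pull_comp : ∀ {X Y Z : C} (f : X ⟶ Y) (g : Y ⟶ Z),
    pull (f ≫ g) = (pull f).comp (pull g)
  /-- Covariant functoriality (pushforward/Gysin maps), by additive maps. -/
  push : ∀ {X Y : C}, (X ⟶ Y) → (E X →+ E Y)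
  push_id : ∀ X : C, push (𝟙 X) = AddMonoidHom.id (E X)
  push_comp : ∀ {X Y Z : C} (f : X ⟶ Y) (g : Y ⟶ Z),
    push (f ≫ g) = (push g).comp (push f)
  /-- Zero axiom: `E ∅ = 0`. -/
  zero : Subsingleton (E (⊥_ C))
  /-- Behavior on sums. -/
  coprod_bij : ∀ X Y : C, Function.Bijective
    (fun a : E (X ⨿ Y) => (pull coprod.inl a, pull coprod.inr a))
  /-- Push-product axiom. -/
  push_product : ∀ {X X' Y Y' : C} (f : X ⟶ X') (g : Y ⟶ Y') (a : E X) (b : E Y),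
    push (prod.map f g) (pull prod.fst a * pull prod.snd b)
      = pull prod.fst (push f a) * pull prod.snd (push g b)
  /-- Push-pull axiom. -/
  push_pull : ∀ {A B C' D' : C} (f : A ⟶ B) (p : A ⟶ C') (q : B ⟶ D') (g : C' ⟶ D'),
    IsPullback f p q g → ∀ a : E C', push f (pull p a) = pull q (push g a)

namespace GysinFunctor

attribute [instance] GysinFunctor.commRing

variable {C : Type u} [Category.{v} C] [HasFiniteLimits C]
  [HasFiniteCoproducts C] [FinitaryExtensive C] (G : GysinFunctor C)

/-- Hom-groups of the category of correspondences: `C_E(A, B) = E(B × A)`. -/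
noncomputable def Hom (A B : C) : Type v := G.E (B ⨯ A)

noncomputable instance (A B : C) : AddCommGroup (G.Hom A B) :=
  inferInstanceAs (AddCommGroup (G.E (B ⨯ A)))

/-- Composition in the category of correspondences. -/
noncomputable def comp {A B Cc : C} (β : G.Hom B Cc) (α : G.Hom A B) : G.Hom A Cc :=
  G.push (prod.map prod.fst (𝟙 A) : (Cc ⨯ B) ⨯ A ⟶ Cc ⨯ A)
    (G.pull (prod.fst : (Cc ⨯ B) ⨯ A ⟶ Cc ⨯ B) β *
      G.pull (prod.map prod.snd (𝟙 A) : (Cc ⨯ B) ⨯ A ⟶ B ⨯ A) α)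

/-- The identity morphism `i_A = Δ_!(1)` in the category of correspondences. -/
noncomputable def ident (A : C) : G.Hom A A := G.push (diag A) 1

/-- `Rf`, the forward map associated to `f : A ⟶ B`. -/
noncomputable def Rmor {A B : C} (f : A ⟶ B) : G.Hom A B :=
  G.push (prod.lift f (𝟙 A)) 1

/-- `If`, the transfer map associated to `f : A ⟶ B`. -/
noncomputable def Imor {A B : C} (f : A ⟶ B) : G.Hom B A :=
  G.push (prod.lift (𝟙 A) f) 1

/-- `Da`, the diagonal endomorphism associated to `a ∈ E(A)`. -/
noncomputable def Dmor {A : C} (a : G.E A) : G.Hom A A := G.push (diag A) a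

/-- The duality anti-automorphism on hom-groups. -/
noncomputable def star {A B : C} (α : G.Hom A B) : G.Hom B A :=
  G.pull (prod.braiding A B).hom α

end GysinFunctor

section PullbackSquares

variable {C : Type u} [Category.{v} C] [HasFiniteLimits C]

lemma isPullback_lift_map_id {P S T B A : C} {s : P ⟶ S} {t : P ⟶ T} {v : S ⟶ B} {p : T ⟶ B}
    (h : IsPullback s t v p) (q : T ⟶ A) :
    IsPullback (prod.lift s (t ≫ q)) t (prod.map v (𝟙 A)) (prod.lift p q) := by
  refine ⟨⟨by ext <;> simp [h.w, prod.lift_fst, prod.lift_snd]⟩,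
    ⟨PullbackCone.IsLimit.mk _ (fun c => h.lift (c.fst ≫ prod.fst) c.snd ?_) ?_ ?_ ?_⟩⟩
  · simpa [prod.lift_fst] using c.condition =≫ prod.fst
  · intro c
    have hc := c.condition =≫ prod.snd
    ext
    · simp [prod.lift_fst]
    · simpa [prod.lift_snd] using hc.symm
  · intro c
    simp
  · intro c m h₁ h₂
    apply h.hom_ext
    · simpa [prod.lift_fst] using h₁ =≫ prod.fst
    · simpa using h₂

lemma isPullback_map_id_fst {X Y : C} (f : X ⟶ Y) (A : C) :
    IsPullback (prod.map f (𝟙 A)) prod.fst prod.fst f := by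
  refine ⟨⟨by simp⟩,
    ⟨PullbackCone.IsLimit.mk _ (fun c => prod.lift c.snd (c.fst ≫ prod.snd)) ?_ ?_ ?_⟩⟩
  · intro c
    ext
    · simp [c.condition, prod.lift_fst]
    · simp [prod.lift_snd]
  · intro c
    simp [prod.lift_fst]
  · intro c m h₁ h₂
    ext
    · simpa [prod.lift_fst] using h₂
    · simpa [prod.lift_snd] using h₁ =≫ prod.snd

lemma isPullback_lift_id_diag {X Y : C} (f : X ⟶ Y) :
    IsPullback f (prod.lift f (𝟙 X)) (diag Y) (prod.map (𝟙 Y) f) := by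
  refine ⟨⟨by ext <;> simp [prod.lift_fst, prod.lift_snd]⟩,
    ⟨PullbackCone.IsLimit.mk _ (fun c => c.snd ≫ prod.snd) ?_ ?_ ?_⟩⟩
  · intro c
    have hc := c.condition =≫ prod.snd
    simpa [prod.lift_snd] using hc.symm
  · intro c
    have h₁ := c.condition =≫ prod.fst
    have h₂ := c.condition =≫ prod.snd
    simp only [Category.assoc, prod.lift_fst, prod.lift_snd, prod.map_fst, prod.map_snd,
      Category.comp_id] at h₁ h₂
    ext
    · simp [← h₁, ← h₂, prod.lift_fst]
    · simp [prod.lift_snd]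
  · intro c m _ h₂
    simpa [prod.lift_snd] using h₂ =≫ prod.snd

end PullbackSquares

namespace GysinFunctor

variable {C : Type u} [Category.{v} C] [HasFiniteLimits C]
  [HasFiniteCoproducts C] [FinitaryExtensive C] (G : GysinFunctor C)

lemma pull_comp_apply {X Y Z : C} (f : X ⟶ Y) (g : Y ⟶ Z) (a : G.E Z) :
    G.pull (f ≫ g) a = G.pull f (G.pull g a) := by
  rw [G.pull_comp]; rfl

lemma push_comp_apply {X Y Z : C} (f : X ⟶ Y) (g : Y ⟶ Z) (a : G.E X) :
    G.push (f ≫ g) a = G.push g (G.push f a) := by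
  rw [G.push_comp]; rfl

lemma pull_id_apply {X : C} (a : G.E X) : G.pull (𝟙 X) a = a := by
  rw [G.pull_id]; rfl

lemma push_id_apply {X : C} (a : G.E X) : G.push (𝟙 X) a = a := by
  rw [G.push_id]; rfl

/-- Frobenius reciprocity (the projection formula). -/
lemma push_pull_mul {X Y : C} (f : X ⟶ Y) (b : G.E Y) (a : G.E X) :
    G.push f (G.pull f b * a) = b * G.push f a := by
  have h := G.push_pull _ _ _ _ (isPullback_lift_id_diag f)
    (G.pull prod.fst b * G.pull prod.snd a)
  rw [G.push_product] at h
  simpa only [map_mul, ← pull_comp_apply, prod.lift_fst, prod.lift_snd, pull_id_apply,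
    push_id_apply] using h

lemma push_mul_pull {X Y : C} (f : X ⟶ Y) (a : G.E X) (b : G.E Y) :
    G.push f (a * G.pull f b) = G.push f a * b := by
  rw [mul_comm, push_pull_mul, mul_comm]

/-- Correspondences pushed forward from spans compose by pullback of spans. -/
lemma comp_push_lift {P S T A B D : C} {s : P ⟶ S} {t : P ⟶ T} {v : S ⟶ B} {p : T ⟶ B}
    (h : IsPullback s t v p) (u : S ⟶ D) (q : T ⟶ A) (a : G.E S) (b : G.E T) :
    G.comp (A := A) (B := B) (Cc := D) (G.push (prod.lift u v) a) (G.push (prod.lift p q) b) =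
      G.push (prod.lift (s ≫ u) (t ≫ q)) (G.pull s a * G.pull t b) := by
  have hv : prod.map (prod.lift u v) (𝟙 A) ≫ prod.map prod.snd (𝟙 A) = prod.map v (𝟙 A) := by
    ext <;> simp [prod.lift_snd]
  have hu : prod.lift s (t ≫ q) ≫ prod.map (prod.lift u v) (𝟙 A) ≫ prod.map prod.fst (𝟙 A) =
      prod.lift (s ≫ u) (t ≫ q) := by
    ext <;> simp [prod.lift_fst, prod.lift_snd]
  unfold comp
  rw [← G.push_pull _ _ _ _ (isPullback_map_id_fst (prod.lift u v) A), ← push_mul_pull,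
    ← pull_comp_apply, hv, ← G.push_pull _ _ _ _ (isPullback_lift_map_id h q), ← push_pull_mul,
    ← pull_comp_apply, prod.lift_fst, ← push_comp_apply, ← push_comp_apply, hu]

lemma comp_push_lift_id {S A D : C} (u : S ⟶ D) (q : S ⟶ A) (a b : G.E S) :
    G.comp (A := A) (B := S) (Cc := D) (G.push (prod.lift u (𝟙 S)) a)
      (G.push (prod.lift (𝟙 S) q) b) = G.push (prod.lift u q) (a * b) := by
  rw [comp_push_lift G (IsPullback.of_id_fst (f := 𝟙 S))]
  simp only [Category.id_comp, pull_id_apply]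
  rfl

end GysinFunctor

open GysinFunctor in
/-- `Rf ∘ Da ∘ Ig = ((f,g))_!(a)`, `Rf ∘ Da ∘ If = D(f_!(a))`, and `Rf ∘ If = D(f_!(1))`. -/
theorem gysinFunctor_RDI_push
    {C : Type u} [Category.{v} C] [HasFiniteLimits C]
    [HasFiniteCoproducts C] [FinitaryExtensive C] (G : GysinFunctor C)
    {X Y Z : C} (f : Z ⟶ Y) (g : Z ⟶ X) (a : G.E Z) :
    G.comp (G.Rmor f) (G.comp (G.Dmor a) (G.Imor g)) = G.push (prod.lift f g) a ∧
    G.comp (G.Rmor f) (G.comp (G.Dmor a) (G.Imor f)) = G.Dmor (G.push f a) ∧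
    G.comp (G.Rmor f) (G.Imor f) = G.Dmor (G.push f (1 : G.E Z)) := by
  have key {W : C} (k : Z ⟶ W) :
      G.comp (G.Rmor f) (G.comp (G.Dmor a) (G.Imor k)) = G.push (prod.lift f k) a := by
    unfold Rmor Dmor Imor
    rw [comp_push_lift_id, mul_one, comp_push_lift_id, one_mul]
  have push_diag (c : G.E Z) : G.push (prod.lift f f) c = G.Dmor (G.push f c) := by
    rw [Dmor, ← push_comp_apply, prod.comp_diag]
  refine ⟨key g, (key f).trans (push_diag a), ?_⟩
  rw [← push_diag, Rmor, Imor, comp_push_lift_id, one_mul]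
end

section
/- Let E be a Gysin functor on a finitary lextensive category C (projection formula). Then for every morphism f : X → Y in C and all elements α ∈ E(X) and β ∈ E(Y), one has f_!(α · f^*(β)) = f_!(α) · β in E(Y). -/
open CategoryTheory CategoryTheory.Limits

universe v u

/-- The graph of `f` is the pullback of the diagonal along `f × 𝟙`. -/
theorem isPullback_graph {C : Type u} [Category.{v} C] [HasFiniteLimits C]
    {X Y : C} (f : X ⟶ Y) :
    IsPullback f (prod.lift (𝟙 X) f) (diag Y) (prod.map f (𝟙 Y)) := by
  refine ⟨⟨by ext <;> simp⟩, ⟨PullbackCone.IsLimit.mk _ (fun s => s.snd ≫ prod.fst) ?_ ?_ ?_⟩⟩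
  · intro s
    simpa [prod.lift_fst] using (s.condition =≫ prod.fst).symm
  · intro s
    have h₁ := s.condition =≫ prod.fst
    have h₂ := s.condition =≫ prod.snd
    simp only [Category.assoc, prod.lift_fst, prod.lift_snd, prod.map_fst, prod.map_snd,
      Category.comp_id] at h₁ h₂
    ext
    · simp [prod.lift_fst]
    · simp [prod.lift_snd, ← h₁, h₂]
  · intro s m _ h
    simp [← h, prod.lift_fst]

namespace GysinFunctor

variable {C : Type u} [Category.{v} C] [HasFiniteLimits C]
  [HasFiniteCoproducts C] [FinitaryExtensive C] (G : GysinFunctor C)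

theorem pull_pull {X Y Z : C} (f : X ⟶ Y) (g : Y ⟶ Z) (a : G.E Z) :
    G.pull f (G.pull g a) = G.pull (f ≫ g) a := by
  rw [G.pull_comp, RingHom.comp_apply]

end GysinFunctor

/-- Projection formula: `f_!(α · f^*(β)) = f_!(α) · β`. -/
theorem gysinFunctor_projection_formula
    {C : Type u} [Category.{v} C] [HasFiniteLimits C]
    [HasFiniteCoproducts C] [FinitaryExtensive C] (G : GysinFunctor C)
    {X Y : C} (f : X ⟶ Y) (α : G.E X) (β : G.E Y) :
    G.push f (α * G.pull f β) = G.push f α * β := by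
  have h := G.push_pull _ _ _ _ (isPullback_graph f)
    (G.pull prod.fst α * G.pull prod.snd β)
  rw [G.push_product] at h
  simpa [GysinFunctor.pull_pull, G.pull_id, G.push_id, prod.lift_fst, prod.lift_snd] using h
end
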